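/- Hitting-time window estimate for the accelerated random walk on ℤ: there exists a constant C (depending only on T) such that for every N > p+2, every 0 < s < t ≤ T and every k ∈ {p+1,…,N−1}: u_N(t,k) − u_N(t−s,k) ≤ C ( s / t^{3/2} + 1 / (N √(t−s)) ). -/

import Mathlib

open Set

namespace BoundaryDriven

/-- The negative discrete Laplacian with rate `c` on the sites `1, …, n`, killed outside them. -/
def dirichletLap (n : ℕ) (c : ℝ) (g : ℕ → ℝ) : ℕ → ℝ
  | 0 => 0
  | i + 1 => if i < n then c * (2 * g (i + 1) - g (i + 2) - g i) else 0

/-- The `L²` pairing on the sites `1, …, n`. -/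
def pairing (n : ℕ) (g h : ℕ → ℝ) : ℝ := ∑ i ∈ Finset.range n, g (i + 1) * h (i + 1)

theorem pairing_comm (n : ℕ) (g h : ℕ → ℝ) : pairing n g h = pairing n h g :=
  Finset.sum_congr rfl fun _ _ => mul_comm _ _

theorem pairing_self_nonneg (n : ℕ) (g : ℕ → ℝ) : 0 ≤ pairing n g g :=
  Finset.sum_nonneg fun _ _ => mul_self_nonneg _

theorem sum_diff_mul_diff (g h : ℕ → ℝ) (n : ℕ) :
    ∑ i ∈ Finset.range (n + 1), (g (i + 1) - g i) * (h (i + 1) - h i) =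
      ∑ i ∈ Finset.range n, g (i + 1) * (2 * h (i + 1) - h (i + 2) - h i) +
        g (n + 1) * (h (n + 1) - h n) - g 0 * (h 1 - h 0) := by
  induction n with
  | zero => simp; ring
  | succ n ih => rw [Finset.sum_range_succ, ih, Finset.sum_range_succ _ n]; ring

theorem pairing_dirichletLap (n : ℕ) (c : ℝ) {g : ℕ → ℝ} (h : ℕ → ℝ) (g0 : g 0 = 0)
    (gn : g (n + 1) = 0) :
    pairing n g (dirichletLap n c h) =
      c * ∑ i ∈ Finset.range (n + 1), (g (i + 1) - g i) * (h (i + 1) - h i) := by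
  rw [sum_diff_mul_diff, g0, gn, zero_mul, zero_mul, add_zero, sub_zero, Finset.mul_sum]
  refine Finset.sum_congr rfl fun i hi => ?_
  rw [dirichletLap, if_pos (Finset.mem_range.1 hi)]
  ring

theorem pairing_dirichletLap_comm (n : ℕ) (c : ℝ) {g h : ℕ → ℝ} (g0 : g 0 = 0)
    (gn : g (n + 1) = 0) (h0 : h 0 = 0) (hn : h (n + 1) = 0) :
    pairing n g (dirichletLap n c h) = pairing n (dirichletLap n c g) h := by
  rw [pairing_comm n _ h, pairing_dirichletLap n c h g0 gn, pairing_dirichletLap n c g h0 hn]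
  simp only [mul_comm]

theorem pairing_dirichletLap_self_nonneg (n : ℕ) {c : ℝ} (hc : 0 ≤ c) {g : ℕ → ℝ}
    (g0 : g 0 = 0) (gn : g (n + 1) = 0) : 0 ≤ pairing n g (dirichletLap n c g) := by
  rw [pairing_dirichletLap n c g g0 gn]
  exact mul_nonneg hc (Finset.sum_nonneg fun _ _ => mul_self_nonneg _)

theorem dirichletLap_zero (n : ℕ) (c : ℝ) (g : ℕ → ℝ) : dirichletLap n c g 0 = 0 := rfl

theorem dirichletLap_last (n : ℕ) (c : ℝ) (g : ℕ → ℝ) : dirichletLap n c g (n + 1) = 0 := by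
  simp [dirichletLap]

/-- Discrete Poincaré inequality in the supremum norm. -/
theorem sq_le_pairing_dirichletLap (n : ℕ) (c : ℝ) (hc : 0 ≤ c) {g : ℕ → ℝ} (g0 : g 0 = 0)
    (gn : g (n + 1) = 0) {j : ℕ} (hj : j ≤ n + 1) :
    c * g j ^ 2 ≤ (n + 1) * pairing n g (dirichletLap n c g) := by
  have tele : g j = ∑ i ∈ Finset.range j, (g (i + 1) - g i) := by
    rw [Finset.sum_range_sub, g0, sub_zero]
  have cs := sq_sum_le_card_mul_sum_sq (s := Finset.range j) (f := fun i => g (i + 1) - g i)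
  rw [← tele, Finset.card_range] at cs
  have mono : ∑ i ∈ Finset.range j, (g (i + 1) - g i) ^ 2 ≤
      ∑ i ∈ Finset.range (n + 1), (g (i + 1) - g i) ^ 2 :=
    Finset.sum_le_sum_of_subset_of_nonneg (Finset.range_mono hj) fun _ _ _ => sq_nonneg _
  have hj' : (j : ℝ) ≤ n + 1 := by exact_mod_cast hj
  have key : g j ^ 2 ≤ (n + 1) * ∑ i ∈ Finset.range (n + 1), (g (i + 1) - g i) ^ 2 :=
    cs.trans (mul_le_mul hj' mono (Finset.sum_nonneg fun _ _ => sq_nonneg _) (by positivity))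
  rw [pairing_dirichletLap n c g g0 gn]
  simp only [← sq]
  calc c * g j ^ 2 ≤ c * _ := mul_le_mul_of_nonneg_left key hc
    _ = _ := by ring

section Flow

variable {n : ℕ} {c : ℝ}

theorem hasDerivAt_dirichletLap {v : ℝ → ℕ → ℝ} {v' : ℕ → ℝ} {t : ℝ}
    (hv : ∀ i, HasDerivAt (fun s => v s i) (v' i) t) (i : ℕ) :
    HasDerivAt (fun s => dirichletLap n c (v s) i) (dirichletLap n c v' i) t := by
  cases i with
  | zero => exact hasDerivAt_const t 0
  | succ i =>
    by_cases hi : i < n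
    · simp only [dirichletLap, if_pos hi]
      exact ((((hv (i + 1)).const_mul 2).sub (hv (i + 2))).sub (hv i)).const_mul c
    · simp only [dirichletLap, if_neg hi]
      exact hasDerivAt_const t 0

theorem continuousOn_dirichletLap {v : ℝ → ℕ → ℝ} {S : Set ℝ}
    (hv : ∀ i, ContinuousOn (fun s => v s i) S) (i : ℕ) :
    ContinuousOn (fun s => dirichletLap n c (v s) i) S := by
  cases i with
  | zero => exact continuousOn_const
  | succ i =>
    by_cases hi : i < n
    · simp only [dirichletLap, if_pos hi]
      exact continuousOn_const.mul
        (((continuousOn_const.mul (hv (i + 1))).sub (hv (i + 2))).sub (hv i))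
    · simp only [dirichletLap, if_neg hi]
      exact continuousOn_const

theorem dirichletLap_neg (g : ℕ → ℝ) (i : ℕ) :
    dirichletLap n c (fun j => -g j) i = -dirichletLap n c g i := by
  cases i with
  | zero => simp [dirichletLap]
  | succ i =>
    simp only [dirichletLap]
    split_ifs
    · ring
    · simp

theorem hasDerivAt_pairing {v w : ℝ → ℕ → ℝ} {v' w' : ℕ → ℝ} {t : ℝ}
    (hv : ∀ i, HasDerivAt (fun s => v s i) (-v' i) t)
    (hw : ∀ i, HasDerivAt (fun s => w s i) (-w' i) t) :
    HasDerivAt (fun s => pairing n (v s) (w s))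
      (-(pairing n v' (w t) + pairing n (v t) w')) t := by
  have := HasDerivAt.fun_sum (u := Finset.range n) fun i _ => (hv (i + 1)).mul (hw (i + 1))
  refine this.congr_deriv ?_
  rw [pairing, pairing, ← Finset.sum_add_distrib, ← Finset.sum_neg_distrib]
  exact Finset.sum_congr rfl fun i _ => by ring

theorem continuousOn_pairing {v w : ℝ → ℕ → ℝ} {S : Set ℝ}
    (hv : ∀ i, ContinuousOn (fun s => v s i) S) (hw : ∀ i, ContinuousOn (fun s => w s i) S) :
    ContinuousOn (fun s => pairing n (v s) (w s)) S :=
  continuousOn_finsetSum _ fun i _ => (hv (i + 1)).mul (hw (i + 1))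

/-- Parabolic smoothing for the discrete Dirichlet heat flow, by a weighted energy estimate. -/
theorem cube_mul_pairing_le {T : ℝ} (hc : 0 ≤ c) {v : ℝ → ℕ → ℝ}
    (v0 : ∀ t, v t 0 = 0) (vn : ∀ t, v t (n + 1) = 0)
    (hcont : ∀ i, ContinuousOn (fun s => v s i) (Icc 0 T))
    (hderiv : ∀ t ∈ Ioo 0 T, ∀ i, HasDerivAt (fun s => v s i) (-dirichletLap n c (v t) i) t)
    {t : ℝ} (ht : t ∈ Icc 0 T) :
    4 / 3 * t ^ 3 * pairing n (dirichletLap n c (v t)) (dirichletLap n c (dirichletLap n c (v t)))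
      ≤ pairing n (v 0) (v 0) := by
  set A := dirichletLap n c with hA
  have cont1 := continuousOn_dirichletLap (n := n) (c := c) hcont
  have cont2 := continuousOn_dirichletLap (n := n) (c := c) cont1
  have hd1 : ∀ t ∈ Ioo 0 T, ∀ i, HasDerivAt (fun s => A (v s) i) (-A (A (v t)) i) t := by
    intro t ht i
    have := hasDerivAt_dirichletLap (n := n) (c := c) (hderiv t ht) i
    rwa [dirichletLap_neg] at this
  have hd2 : ∀ t ∈ Ioo 0 T, ∀ i, HasDerivAt (fun s => A (A (v s)) i) (-A (A (A (v t))) i) t := by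
    intro t ht i
    have := hasDerivAt_dirichletLap (n := n) (c := c) (hd1 t ht) i
    rwa [dirichletLap_neg] at this
  set Φ : ℝ → ℝ := fun t => pairing n (v t) (v t) + 2 * t * pairing n (v t) (A (v t)) +
    2 * t ^ 2 * pairing n (A (v t)) (A (v t)) +
    4 / 3 * t ^ 3 * pairing n (A (v t)) (A (A (v t))) with hΦ
  have hΦd : ∀ t ∈ Ioo 0 T,
      HasDerivAt Φ (-(8 / 3 * t ^ 3 * pairing n (A (A (v t))) (A (A (v t))))) t := by
    intro t ht
    have e0 := hasDerivAt_pairing (n := n) (hderiv t ht) (hderiv t ht)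
    have e1 := hasDerivAt_pairing (n := n) (hderiv t ht) (hd1 t ht)
    have e2 := hasDerivAt_pairing (n := n) (hd1 t ht) (hd1 t ht)
    have e3 := hasDerivAt_pairing (n := n) (hd1 t ht) (hd2 t ht)
    have p1 : HasDerivAt (fun s : ℝ => 2 * s) 2 t := by
      simpa using (hasDerivAt_id t).const_mul 2
    have p2 : HasDerivAt (fun s : ℝ => 2 * s ^ 2) (4 * t) t := by
      exact ((hasDerivAt_pow 2 t).const_mul 2).congr_deriv (by push_cast; ring)
    have p3 : HasDerivAt (fun s : ℝ => 4 / 3 * s ^ 3) (4 * t ^ 2) t := by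
      exact ((hasDerivAt_pow 3 t).const_mul (4 / 3)).congr_deriv (by push_cast; ring)
    refine (((e0.add (p1.mul e1)).add (p2.mul e2)).add (p3.mul e3)).congr_deriv ?_
    have s1 : pairing n (v t) (A (A (v t))) = pairing n (A (v t)) (A (v t)) :=
      pairing_dirichletLap_comm n c (v0 t) (vn t) (dirichletLap_zero ..) (dirichletLap_last ..)
    have s2 : pairing n (A (v t)) (A (A (A (v t)))) = pairing n (A (A (v t))) (A (A (v t))) :=
      pairing_dirichletLap_comm n c (dirichletLap_zero ..) (dirichletLap_last ..)
        (dirichletLap_zero ..) (dirichletLap_last ..)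
    rw [s1, s2, pairing_comm n (A (v t)) (v t), pairing_comm n (A (A (v t))) (A (v t))]
    ring
  have hΦc : ContinuousOn Φ (Icc 0 T) := by
    have e0 := continuousOn_pairing (n := n) hcont hcont
    have e1 := continuousOn_pairing (n := n) hcont cont1
    have e2 := continuousOn_pairing (n := n) cont1 cont1
    have e3 := continuousOn_pairing (n := n) cont1 cont2
    exact ((e0.add (ContinuousOn.mul (by fun_prop) e1)).add
      (ContinuousOn.mul (by fun_prop) e2)).add (ContinuousOn.mul (by fun_prop) e3)
  have anti : AntitoneOn Φ (Icc 0 T) := by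
    refine antitoneOn_of_deriv_nonpos (convex_Icc 0 T) hΦc ?_ ?_
    · rw [interior_Icc]
      exact fun t ht => (hΦd t ht).differentiableAt.differentiableWithinAt
    · rw [interior_Icc]
      intro t ht
      rw [(hΦd t ht).deriv]
      have := pairing_self_nonneg n (A (A (v t)))
      have := ht.1
      rw [neg_nonpos]
      positivity
  have h := anti (left_mem_Icc.2 (ht.1.trans ht.2)) ht ht.1
  have h0 : Φ 0 = pairing n (v 0) (v 0) := by simp [hΦ]
  rw [h0] at h
  have q0 := pairing_self_nonneg n (v t)
  have q1 : 0 ≤ pairing n (v t) (A (v t)) := pairing_dirichletLap_self_nonneg n hc (v0 t) (vn t)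
  have q2 := pairing_self_nonneg n (A (v t))
  have t0 := ht.1
  have r1 : 0 ≤ 2 * t * pairing n (v t) (A (v t)) := by positivity
  have r2 : 0 ≤ 2 * t ^ 2 * pairing n (A (v t)) (A (v t)) := by positivity
  simp only [hΦ] at h
  linarith

/-- Pointwise decay of the time derivative of the discrete Dirichlet heat flow. -/
theorem cube_mul_dirichletLap_sq_le {T : ℝ} (hc : ((n : ℝ) + 1) ^ 2 ≤ c) {v : ℝ → ℕ → ℝ}
    (v0 : ∀ t, v t 0 = 0) (vn : ∀ t, v t (n + 1) = 0)
    (hcont : ∀ i, ContinuousOn (fun s => v s i) (Icc 0 T))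
    (hderiv : ∀ t ∈ Ioo 0 T, ∀ i, HasDerivAt (fun s => v s i) (-dirichletLap n c (v t) i) t)
    (hinit : ∀ i, |v 0 i| ≤ 1) {t : ℝ} (ht : t ∈ Icc 0 T) {j : ℕ} (hj : j ≤ n + 1) :
    4 / 3 * t ^ 3 * dirichletLap n c (v t) j ^ 2 ≤ 1 := by
  have hc0 : 0 < c := lt_of_lt_of_le (by positivity) hc
  have h1 := cube_mul_pairing_le hc0.le v0 vn hcont hderiv ht
  have h2 := sq_le_pairing_dirichletLap n c hc0.le (dirichletLap_zero n c (v t))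
    (dirichletLap_last n c (v t)) hj
  have h3 : pairing n (v 0) (v 0) ≤ n + 1 := by
    calc pairing n (v 0) (v 0) ≤ ∑ i ∈ Finset.range n, (1 : ℝ) := by
          refine Finset.sum_le_sum fun i _ => ?_
          rw [← sq, ← sq_abs]
          exact pow_le_one₀ (abs_nonneg _) (hinit _)
      _ ≤ n + 1 := by simp
  have t0 : 0 ≤ 4 / 3 * t ^ 3 := by have := ht.1; positivity
  have h4 := mul_le_mul_of_nonneg_left h2 t0
  have h5 := mul_le_mul_of_nonneg_left (h1.trans h3) (show (0 : ℝ) ≤ n + 1 by positivity)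
  refine le_of_mul_le_mul_left ?_ hc0
  nlinarith

end Flow

/-- The time derivative of the hitting probability is at most of order `t ^ (-3 / 2)`. -/
theorem cube_mul_rate_sq_le {p N : ℕ} {T : ℝ} (hN : p + 2 < N) {u : ℝ → ℤ → ℝ}
    (hbd : ∀ t ∈ Icc (0 : ℝ) T, u t ((p : ℤ) + 1) = 1 ∧ u t ((N : ℤ) - 1) = 1)
    (hinit : ∀ k : ℤ, k ≠ (p : ℤ) + 1 → k ≠ (N : ℤ) - 1 → u 0 k = 0)
    (hheat : ∀ k : ℤ, k ≠ (p : ℤ) + 1 → k ≠ (N : ℤ) - 1 →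
      ContinuousOn (fun t => u t k) (Icc 0 T) ∧
      ∀ t ∈ Ioo (0 : ℝ) T, HasDerivAt (fun s => u s k)
        ((N : ℝ) ^ 2 * (u t (k + 1) + u t (k - 1) - 2 * u t k)) t)
    {t : ℝ} (ht : t ∈ Icc 0 T) {k : ℤ} (hk : (p : ℤ) + 1 < k) (hk' : k < (N : ℤ) - 1) :
    4 / 3 * t ^ 3 * ((N : ℝ) ^ 2 * (u t (k + 1) + u t (k - 1) - 2 * u t k)) ^ 2 ≤ 1 := by
  obtain ⟨n, rfl⟩ : ∃ n, N = p + n + 3 := ⟨N - p - 3, by omega⟩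
  set v : ℝ → ℕ → ℝ := fun t i => if 0 < i ∧ i ≤ n then 1 - u t (p + 1 + i) else 0 with hv
  have hvu : ∀ t ∈ Icc (0 : ℝ) T, ∀ i ≤ n + 1, v t i = 1 - u t (p + 1 + i) := by
    intro t ht i hi
    simp only [hv]
    split_ifs with h
    · rfl
    · rcases (by omega : i = 0 ∨ i = n + 1) with rfl | rfl
      · simp [(hbd t ht).1]
      · have := (hbd t ht).2
        rw [show (p : ℤ) + 1 + ((n + 1 : ℕ) : ℤ) = ((p + n + 3 : ℕ) : ℤ) - 1 by push_cast; ring,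
          this, sub_self]
  have hlap : ∀ t ∈ Icc (0 : ℝ) T, ∀ i < n, dirichletLap n (((p + n + 3 : ℕ) : ℝ) ^ 2) (v t) (i + 1)
      = ((p + n + 3 : ℕ) : ℝ) ^ 2 * (u t (p + 1 + (i + 1 : ℕ) + 1) + u t (p + 1 + (i + 1 : ℕ) - 1)
        - 2 * u t (p + 1 + (i + 1 : ℕ))) := by
    intro t ht i hi
    rw [dirichletLap, if_pos hi, hvu t ht _ (by omega), hvu t ht _ (by omega),
      hvu t ht _ (by omega),
      show (p : ℤ) + 1 + ((i + 2 : ℕ) : ℤ) = p + 1 + (i + 1 : ℕ) + 1 by push_cast; ring,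
      show (p : ℤ) + 1 + (i : ℤ) = p + 1 + (i + 1 : ℕ) - 1 by push_cast; ring]
    ring
  obtain ⟨j, rfl⟩ : ∃ j : ℕ, k = p + 1 + (j + 1 : ℕ) := ⟨(k - p - 2).toNat, by omega⟩
  rw [← hlap t ht j (by omega)]
  refine cube_mul_dirichletLap_sq_le ?_ (by simp [hv]) (by simp [hv]) ?_ ?_ ?_ ht (by omega)
  · push_cast
    gcongr
    · linarith [(p.cast_nonneg : (0 : ℝ) ≤ p)]
    · norm_num
  · intro i
    by_cases h : 0 < i ∧ i ≤ n
    · simp only [hv, if_pos h]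
      exact continuousOn_const.sub (hheat _ (by omega) (by omega)).1
    · simp only [hv, if_neg h]
      exact continuousOn_const
  · intro t ht i
    by_cases h : 0 < i ∧ i ≤ n
    · obtain ⟨i, rfl⟩ : ∃ l, i = l + 1 := ⟨i - 1, by omega⟩
      rw [hlap t (Ioo_subset_Icc_self ht) i (by omega)]
      simp only [hv, if_pos h]
      exact ((hheat _ (by omega) (by omega)).2 t ht).const_sub 1
    · have hz : dirichletLap n (((p + n + 3 : ℕ) : ℝ) ^ 2) (v t) i = 0 := by
        cases i with
        | zero => rfl
        | succ i => rw [dirichletLap, if_neg (by omega)]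
      rw [hz, neg_zero]
      simp only [hv, if_neg h]
      exact hasDerivAt_const t 0
  · intro i
    by_cases h : 0 < i ∧ i ≤ n
    · simp only [hv, if_pos h]
      rw [hinit _ (by omega) (by omega)]
      simp
    · simp only [hv, if_neg h]
      simp

/-- hitting-time window estimate for the accelerated random walk on ℤ.
Here `u t k` is the probability that the continuous-time simple random walk on ℤ,
jumping at rate `N²` to each nearest neighbour and started from `k`, has hit the set
`{p+1, N−1}` by time `t`; it is characterised as the solution of the discrete heat
equation with the stated boundary/initial conditions. -/
theorem hitting_time_window_estimate
    (p : ℕ) (hp : 1 ≤ p) (T : ℝ) (hT : 0 < T) :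
    ∃ C : ℝ, ∀ N : ℕ, p + 2 < N → ∀ u : ℝ → ℤ → ℝ,
      (∀ t ∈ Set.Icc (0 : ℝ) T, ∀ k : ℤ, u t k ∈ Set.Icc (0 : ℝ) 1) →
      (∀ t ∈ Set.Icc (0 : ℝ) T, u t ((p : ℤ) + 1) = 1 ∧ u t ((N : ℤ) - 1) = 1) →
      (∀ k : ℤ, k ≠ (p : ℤ) + 1 → k ≠ (N : ℤ) - 1 → u 0 k = 0) →
      (∀ k : ℤ, k ≠ (p : ℤ) + 1 → k ≠ (N : ℤ) - 1 →
        ContinuousOn (fun t => u t k) (Set.Icc 0 T) ∧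
        ∀ t ∈ Set.Ioo (0 : ℝ) T, HasDerivAt (fun s => u s k)
          ((N : ℝ) ^ 2 * (u t (k + 1) + u t (k - 1) - 2 * u t k)) t) →
      ∀ s t : ℝ, 0 < s → s < t → t ≤ T →
        ∀ k : ℤ, (p : ℤ) + 1 ≤ k → k ≤ (N : ℤ) - 1 →
          u t k - u (t - s) k ≤
            C * (s / t ^ ((3 : ℝ) / 2) + 1 / (N * Real.sqrt (t - s))) := by
  refine ⟨3 + 2 * √T, ?_⟩
  intro N hN u hu hbd hinit hheat s t hs hst htT k hk hk'
  have ht : 0 < t := hs.trans hst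
  have hq : t ^ ((3 : ℝ) / 2) = t * √t := by
    rw [show (3 : ℝ) / 2 = 1 + 1 / 2 by norm_num, Real.rpow_add ht, Real.rpow_one,
      Real.sqrt_eq_rpow]
  have hqpos : 0 < t * √t := by positivity
  rw [hq]
  have htmem : t ∈ Icc 0 T := ⟨ht.le, htT⟩
  have htsmem : t - s ∈ Icc 0 T := ⟨by linarith, by linarith⟩
  suffices h : u t k - u (t - s) k ≤ (3 + 2 * √T) * (s / (t * √t)) by
    refine h.trans (mul_le_mul_of_nonneg_left ?_ (by positivity))
    exact le_add_of_nonneg_right (by positivity)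
  have hterm1 : 0 ≤ 3 * (s / (t * √t)) := by positivity
  have hterm2 : 0 ≤ 2 * √T * (s / (t * √t)) := by positivity
  by_cases hb : k = (p : ℤ) + 1 ∨ k = (N : ℤ) - 1
  · have : u t k - u (t - s) k = 0 := by
      rcases hb with rfl | rfl
      · rw [(hbd t htmem).1, (hbd _ htsmem).1, sub_self]
      · rw [(hbd t htmem).2, (hbd _ htsmem).2, sub_self]
    linarith
  push Not at hb
  rcases le_total (t / 2) s with hlarge | hsmall
  · have h1 := (hu t htmem k).2
    have h2 := (hu _ htsmem k).1
    have h3 : 1 ≤ 2 * √T * (s / (t * √t)) := by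
      rw [← mul_div_assoc, one_le_div hqpos]
      have := Real.sqrt_le_sqrt htT
      nlinarith [Real.sqrt_nonneg t, Real.sqrt_nonneg T]
    linarith
  · obtain ⟨hcont, hderiv⟩ := hheat k hb.1 hb.2
    have hsub : Icc (t - s) t ⊆ Icc 0 T := Icc_subset_Icc htsmem.1 htT
    have hsub' : Ioo (t - s) t ⊆ Ioo 0 T := Ioo_subset_Ioo htsmem.1 htT
    have key := (convex_Icc (t - s) t).image_sub_le_mul_sub_of_deriv_le (hcont.mono hsub)
      (C := 3 / (t * √t)) (by
        rw [interior_Icc]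
        exact fun r hr => (hderiv r (hsub' hr)).differentiableAt.differentiableWithinAt) (by
        rw [interior_Icc]
        intro r hr
        rw [(hderiv r (hsub' hr)).deriv]
        have hrate := cube_mul_rate_sq_le hN hbd hinit hheat (Ioo_subset_Icc_self (hsub' hr))
          (lt_of_le_of_ne hk (Ne.symm hb.1)) (lt_of_le_of_ne hk' hb.2)
        set f := (N : ℝ) ^ 2 * (u r (k + 1) + u r (k - 1) - 2 * u r k)
        have hr2 : t / 2 ≤ r := by linarith [hr.1]
        have hr3 : (t / 2) ^ 3 ≤ r ^ 3 := pow_le_pow_left₀ (by positivity) hr2 3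
        have hcube : (t * √t) ^ 2 = t ^ 3 := by rw [mul_pow, Real.sq_sqrt ht.le]; ring
        rw [le_div_iff₀ hqpos]
        refine le_of_abs_le (abs_le_of_sq_le_sq ?_ (by norm_num))
        rw [mul_pow, hcube]
        nlinarith [mul_le_mul_of_nonneg_right hr3 (sq_nonneg f)])
      (t - s) (left_mem_Icc.2 (by linarith)) t (right_mem_Icc.2 (by linarith)) (by linarith)
    have : 3 / (t * √t) * (t - (t - s)) = 3 * (s / (t * √t)) := by ring
    linarith

end BoundaryDriven
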